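/- There is no monic real polynomial P = x⁴ + b₃x³ + b₂x² + b₁x + b₀ with b₃ < 0, b₂ < 0, b₁ < 0, b₀ > 0 that has two real roots r and −r for some r > 0 (i.e., P(r) = P(−r) = 0 with r > 0 is impossible). -/

import Mathlib

/-- No monic real quartic with sign pattern `(+,−,−,−,+)` has two real roots `r` and
`−r` with `r > 0`. -/
theorem stmt_3 :
    ¬ ∃ (b₃ b₂ b₁ b₀ r : ℝ), b₃ < 0 ∧ b₂ < 0 ∧ b₁ < 0 ∧ 0 < b₀ ∧ 0 < r ∧
      r ^ 4 + b₃ * r ^ 3 + b₂ * r ^ 2 + b₁ * r + b₀ = 0 ∧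
      (-r) ^ 4 + b₃ * (-r) ^ 3 + b₂ * (-r) ^ 2 + b₁ * (-r) + b₀ = 0 := by
  rintro ⟨b₃, b₂, b₁, b₀, r, h₃, -, h₁, -, hr, hpos, hneg⟩
  have hcubic : b₃ * r ^ 3 < 0 := mul_neg_of_neg_of_pos h₃ (pow_pos hr 3)
  have hlinear : b₁ * r < 0 := mul_neg_of_neg_of_pos h₁ hr
  have hodd : b₃ * r ^ 3 + b₁ * r = 0 := by linear_combination (hpos - hneg) / 2
  linarith
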